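/- arXiv:2211.13284 — 2 statements merged into one kernel-verified Lean document; each statement's English description precedes it below -/
import Mathlib

section
/- For every l ≥ 1 with (D,l) ≠ (2,1), and all indices i_2,…,i_l ∈ {1,…,D}: Σ_{h=1}^D x^h·X_l^{h i_2…i_l} = (r²/(D+2l−2))·[D + l − 1 − (2l−2)/(D+2l−4)]·X_{l−1}^{i_2…i_l}, where r² = Σ_i (x^i)². -/
open scoped BigOperators

noncomputable section
namespace Fuzzy

/-- Matrices acting on `ℂ^D ⊗ ℂ^D`, indexed by pairs. -/
abbrev PairMat (D : ℕ) := Matrix (Fin D × Fin D) (Fin D × Fin D) ℂ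

/-- The flip (permutation) operator `𝖯` on `ℂ^D ⊗ ℂ^D`: `𝖯^{hi}_{jk} = δ^h_k δ^i_j`. -/
def flipMat (D : ℕ) : PairMat D := fun p q => if p.1 = q.2 ∧ p.2 = q.1 then 1 else 0

/-- The trace projector `𝒫ᵗ`: `𝒫ᵗ{}^{hi}_{jk} = δ^{hi} δ_{jk} / D`. -/
def traceMat (D : ℕ) : PairMat D :=
  fun p q => (if p.1 = p.2 then 1 else 0) * (if q.1 = q.2 then 1 else 0) / (D : ℂ)

/-- The symmetric projector `𝒫⁺ = (1 + 𝖯)/2`. -/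
def symPlusMat (D : ℕ) : PairMat D := (2 : ℂ)⁻¹ • ((1 : PairMat D) + flipMat D)

/-- The antisymmetric projector `𝒫⁻ = (1 − 𝖯)/2`. -/
def symMinusMat (D : ℕ) : PairMat D := (2 : ℂ)⁻¹ • ((1 : PairMat D) - flipMat D)

/-- The trace-free symmetric projector `𝒫 = 𝒫⁺ − 𝒫ᵗ`. -/
def PsMat (D : ℕ) : PairMat D := symPlusMat D - traceMat D

/-- `𝒫′ = 𝒫⁻ + 𝒫ᵗ`. -/
def PprimeMat (D : ℕ) : PairMat D := symMinusMat D + traceMat D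

/-- Embedding of an operator on `ℂ^D ⊗ ℂ^D` acting on the tensor factors `n, n+1`
(0-based) of `(ℂ^D)^{⊗ l}`, and as the identity on the other factors. -/
def embAt (D l n : ℕ) (A : PairMat D) :
    Matrix (Fin l → Fin D) (Fin l → Fin D) ℂ := fun i j =>
  if h : n + 1 < l then
    A (i ⟨n, Nat.lt_of_succ_lt h⟩, i ⟨n + 1, h⟩) (j ⟨n, Nat.lt_of_succ_lt h⟩, j ⟨n + 1, h⟩) *
      ∏ m : Fin l, (if m.val = n ∨ m.val = n + 1 then 1 else if i m = j m then 1 else 0)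
  else 0

/-- Extension of an operator on `(ℂ^D)^{⊗ l}` to `(ℂ^D)^{⊗ (l+1)}`, acting as the
identity on the last tensor factor. -/
def extendLast (D l : ℕ) (A : Matrix (Fin l → Fin D) (Fin l → Fin D) ℂ) :
    Matrix (Fin (l + 1) → Fin D) (Fin (l + 1) → Fin D) ℂ := fun i j =>
  A (fun m => i m.castSucc) (fun m => j m.castSucc) *
    (if i (Fin.last l) = j (Fin.last l) then 1 else 0)

/-- Extension of an operator on `(ℂ^D)^{⊗ l}` to `(ℂ^D)^{⊗ (l+1)}`, acting as the
identity on the first tensor factor. -/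
def extendFirst (D l : ℕ) (A : Matrix (Fin l → Fin D) (Fin l → Fin D) ℂ) :
    Matrix (Fin (l + 1) → Fin D) (Fin (l + 1) → Fin D) ℂ := fun i j =>
  A (fun m => i m.succ) (fun m => j m.succ) * (if i 0 = j 0 then 1 else 0)

/-- The matrix `M(l+1) = (1/(l+1)) [1 + l·𝖯 − (2Dl/(D+2l−2))·𝒫ᵗ]`. -/
def MStep (D l : ℕ) : PairMat D :=
  ((l : ℂ) + 1)⁻¹ •
    ((1 : PairMat D) + (l : ℂ) • flipMat D -
      (2 * (D : ℂ) * (l : ℂ) / ((D : ℂ) + 2 * (l : ℂ) - 2)) • traceMat D)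

/-- The completely symmetric trace-free projector `𝒫^l` on `(ℂ^D)^{⊗ l}`, defined
recursively by `𝒫^1 = id`, `𝒫^{l+1} = 𝒫^l_{1…l} M(l+1)_{l(l+1)} 𝒫^l_{1…l}`. -/
def symProj (D : ℕ) : (l : ℕ) → Matrix (Fin l → Fin D) (Fin l → Fin D) ℂ
  | 0 => 1
  | 1 => 1
  | (l + 2) =>
      extendLast D (l + 1) (symProj D (l + 1)) * embAt D (l + 2) l (MStep D (l + 1)) *
        extendLast D (l + 1) (symProj D (l + 1))


open MvPolynomial

/-- Complex polynomials in `E` variables. -/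
abbrev Poly (E : ℕ) := MvPolynomial (Fin E) ℂ

/-- The Laplacian `Δ = Σ_i ∂_i ∂_i`. -/
def lap {E : ℕ} (φ : Poly E) : Poly E := ∑ i : Fin E, pderiv i (pderiv i φ)

/-- The angular momentum operator `L_{ij} = i (x^j ∂_i − x^i ∂_j)`. -/
def ang {E : ℕ} (i j : Fin E) (φ : Poly E) : Poly E :=
  Complex.I • (X j * pderiv i φ - X i * pderiv j φ)

/-- The square angular momentum `L² = (1/2) Σ_{i,j} L_{ij} L_{ij}`. -/
def lsq {E : ℕ} (φ : Poly E) : Poly E :=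
  (2 : ℂ)⁻¹ • ∑ i : Fin E, ∑ j : Fin E, ang i j (ang i j φ)

/-- The Euler (dilatation) operator `η = Σ_i x^i ∂_i`. -/
def eta {E : ℕ} (φ : Poly E) : Poly E := ∑ i : Fin E, X i * pderiv i φ

/-- `r² = Σ_i (x^i)²`. -/
def r2 (E : ℕ) : Poly E := ∑ i : Fin E, X i * X i

/-- The harmonic polynomials `X_l^{i_1…i_l} := 𝒫^l{}^{i_1…i_l}_{j_1…j_l} x^{j_1} ⋯ x^{j_l}`. -/
def harmX (E l : ℕ) (i : Fin l → Fin E) : Poly E :=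
  ∑ j : Fin l → Fin E, symProj E l i j • ∏ m : Fin l, X (j m)

end Fuzzy

namespace Fuzzy

open MvPolynomial

def sn {D n : ℕ} (i : Fin n → Fin D) (x : Fin D) : Fin (n + 1) → Fin D :=
  Fin.snoc (α := fun _ => Fin D) i x

@[simp] lemma sn_castSucc {D n : ℕ} (i : Fin n → Fin D) (x : Fin D) (k : Fin n) :
    sn i x k.castSucc = i k := by simp [sn]

@[simp] lemma sn_last {D n : ℕ} (i : Fin n → Fin D) (x : Fin D) :
    sn i x (Fin.last n) = x := by simp [sn]

lemma exists_sn {D n : ℕ} (i : Fin (n + 1) → Fin D) : ∃ i' x, i = sn i' x :=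
  ⟨fun k => i k.castSucc, i (Fin.last n), by
    funext k
    refine Fin.lastCases ?_ (fun k => ?_) k <;> simp⟩

lemma sum_sn {D n : ℕ} {V : Type*} [AddCommMonoid V] (g : (Fin (n + 1) → Fin D) → V) :
    ∑ j, g j = ∑ j : Fin n → Fin D, ∑ x : Fin D, g (sn j x) := by
  rw [← (Fin.snocEquiv (fun _ : Fin (n + 1) => Fin D)).sum_comp, Fintype.sum_prod_type,
    Finset.sum_comm]
  rfl

/-- Action of a matrix on a module-valued tensor. -/
def act {I V : Type*} [Fintype I] [AddCommGroup V] [Module ℂ V] (A : Matrix I I ℂ) (v : I → V) :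
    I → V := fun i => ∑ j, A i j • v j

section
variable {V : Type*} [AddCommGroup V] [Module ℂ V]

lemma act_mul {I : Type*} [Fintype I] (A B : Matrix I I ℂ) (v : I → V) :
    act (A * B) v = act A (act B v) := by
  funext i
  simp only [act, Matrix.mul_apply, Finset.sum_smul, Finset.smul_sum, smul_smul]
  exact Finset.sum_comm

lemma act_one {I : Type*} [Fintype I] [DecidableEq I] (v : I → V) :
    act (1 : Matrix I I ℂ) v = v := by
  funext i
  simp [act, Matrix.one_apply]

lemma mul_col {I : Type*} [Fintype I] (A B : Matrix I I ℂ) (j : I) :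
    (fun i => (A * B) i j) = act A (fun i => B i j) := by
  funext i
  simp [act, Matrix.mul_apply]

lemma mul_col_apply {I : Type*} [Fintype I] (A B : Matrix I I ℂ) (i j : I) :
    (A * B) i j = act A (fun i => B i j) i := by
  simp [act, Matrix.mul_apply]

lemma act_extendLast {D n : ℕ} (A : Matrix (Fin n → Fin D) (Fin n → Fin D) ℂ)
    (v : (Fin (n + 1) → Fin D) → V) (i : Fin n → Fin D) (x : Fin D) :
    act (extendLast D n A) v (sn i x) = act A (fun k => v (sn k x)) i := by
  simp only [act, sum_sn, extendLast, sn_castSucc, sn_last]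
  refine Finset.sum_congr rfl fun k _ => ?_
  simp

lemma prod_delta {D n : ℕ} (i j : Fin n → Fin D) :
    (∏ m : Fin n, (if i m = j m then (1 : ℂ) else 0)) = if i = j then 1 else 0 := by
  rw [Finset.prod_ite_zero]
  simp [funext_iff]

lemma embAt_sn {D n : ℕ} (A : PairMat D) (i j : Fin n → Fin D) (x y x' y' : Fin D) :
    embAt D (n + 2) n A (sn (sn i x) y) (sn (sn j x') y') =
      A (x, y) (x', y') * if i = j then 1 else 0 := by
  have h1 : (⟨n, by omega⟩ : Fin (n + 2)) = (Fin.last n).castSucc := rfl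
  have h2 : (⟨n + 1, by omega⟩ : Fin (n + 2)) = Fin.last (n + 1) := rfl
  rw [embAt, dif_pos (by omega), h1, h2, ← prod_delta, Fin.prod_univ_castSucc,
    Fin.prod_univ_castSucc]
  simp only [sn_castSucc, sn_last]
  congr 1
  simp only [Fin.val_castSucc, Fin.val_last, true_or, or_true, if_true, mul_one]
  refine Finset.prod_congr rfl fun m _ => ?_
  rw [if_neg (by omega)]

lemma act_embAt {D n : ℕ} (A : PairMat D) (v : (Fin (n + 2) → Fin D) → V)
    (i : Fin n → Fin D) (x y : Fin D) :
    act (embAt D (n + 2) n A) v (sn (sn i x) y) =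
      ∑ x', ∑ y', A (x, y) (x', y') • v (sn (sn i x') y') := by
  simp only [act, sum_sn, embAt_sn]
  rw [Finset.sum_eq_single i]
  · simp
  · intro b _ hb
    simp [Ne.symm hb]
  · simp

def bet (D l : ℕ) : ℂ := 2 * (l : ℂ) / ((D : ℂ) + 2 * (l : ℂ) - 2)

lemma act_MStep {D n : ℕ} (hD : 2 ≤ D) (l : ℕ) (v : (Fin (n + 2) → Fin D) → V)
    (i : Fin n → Fin D) (x y : Fin D) :
    act (embAt D (n + 2) n (MStep D l)) v (sn (sn i x) y) =
      ((l : ℂ) + 1)⁻¹ • (v (sn (sn i x) y) + (l : ℂ) • v (sn (sn i y) x)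
        - bet D l • (if x = y then (1 : ℂ) else 0) • ∑ t, v (sn (sn i t) t)) := by
  have hD' : (D : ℂ) ≠ 0 := by
    have : D ≠ 0 := by omega
    exact_mod_cast this
  rw [act_embAt]
  have h1 : ∑ x', ∑ y', (1 : PairMat D) (x, y) (x', y') • v (sn (sn i x') y')
      = v (sn (sn i x) y) := by
    simp [Matrix.one_apply, Prod.ext_iff, ite_and]
  have h2 : ∑ x', ∑ y', flipMat D (x, y) (x', y') • v (sn (sn i x') y')
      = v (sn (sn i y) x) := by
    simp [flipMat, ite_and]
  have h3 : ∑ x', ∑ y', traceMat D (x, y) (x', y') • v (sn (sn i x') y')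
      = (D : ℂ)⁻¹ • (if x = y then (1 : ℂ) else 0) • ∑ t, v (sn (sn i t) t) := by
    simp only [traceMat, Finset.smul_sum]
    refine Finset.sum_congr rfl fun t _ => ?_
    rw [Finset.sum_eq_single t]
    · simp only [if_true, mul_one, div_eq_mul_inv, smul_smul]
      rw [mul_comm]
    · intro b _ hb
      simp [Ne.symm hb]
    · simp
  have h4 : bet D l = (2 * (D : ℂ) * (l : ℂ) / ((D : ℂ) + 2 * (l : ℂ) - 2)) * (D : ℂ)⁻¹ := by
    unfold bet
    field_simp
  rw [h4, mul_smul, ← h1, ← h2, ← h3]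
  simp only [h2]
  simp only [MStep, Matrix.smul_apply, Matrix.sub_apply, Matrix.add_apply, smul_eq_mul,
    Finset.smul_sum, ← Finset.sum_add_distrib, ← Finset.sum_sub_distrib, mul_smul, add_smul,
    sub_smul, smul_add, smul_sub]
  rw [← h2]
  simp only [Finset.smul_sum, ← Finset.sum_add_distrib, ← Finset.sum_sub_distrib]

end

lemma symProj_succ (D n : ℕ) : symProj D (n + 2) =
    extendLast D (n + 1) (symProj D (n + 1)) * embAt D (n + 2) n (MStep D (n + 1)) *
        extendLast D (n + 1) (symProj D (n + 1)) := by
  rw [symProj]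

lemma mat_ext {I : Type*} [Fintype I] {A B : Matrix I I ℂ}
    (h : ∀ (v : I → ℂ), act A v = act B v) : A = B := by
  classical
  ext i j
  have := congrFun (h (fun k => if k = j then 1 else 0)) i
  simpa [act] using this

lemma extendLast_mul {D n : ℕ} (A B : Matrix (Fin n → Fin D) (Fin n → Fin D) ℂ) :
    extendLast D n (A * B) = extendLast D n A * extendLast D n B := by
  refine mat_ext fun v => ?_
  funext i
  obtain ⟨i, x, rfl⟩ := exists_sn i
  rw [act_mul, act_extendLast, act_extendLast, act_mul]
  simp only [act_extendLast]

/-- Far-away operators commute. -/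
lemma ext_comm {D n : ℕ} (A : Matrix (Fin n → Fin D) (Fin n → Fin D) ℂ) (M : PairMat D) :
    extendLast D (n + 1) (extendLast D n A) * embAt D (n + 2) n M =
      embAt D (n + 2) n M * extendLast D (n + 1) (extendLast D n A) := by
  refine mat_ext fun v => ?_
  funext i
  obtain ⟨i, y, rfl⟩ := exists_sn i
  obtain ⟨i, x, rfl⟩ := exists_sn i
  rw [act_mul, act_mul, act_extendLast, act_extendLast, act_embAt]
  simp only [act_extendLast, act_embAt]
  simp only [act, Finset.smul_sum]
  rw [Finset.sum_comm]
  refine Finset.sum_congr rfl fun a _ => ?_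
  rw [Finset.sum_comm]
  refine Finset.sum_congr rfl fun b _ => Finset.sum_congr rfl fun c _ => ?_
  exact smul_comm _ _ _

/-- The three-strand computation. -/
lemma three_strand {D : ℕ} (l a b : ℂ) (v G : Fin D → Fin D → Fin D → ℂ)
    (hs : ∀ x y z, v x y z = v y x z) (ht : ∀ z, ∑ t, v t t z = 0)
    (w : Fin D → Fin D → Fin D → ℂ)
    (hw : ∀ x y z, w x y z = v x y z + l * v x z y -
      b * ((if y = z then 1 else 0) * ∑ t, v x t t))
    (hG : ∀ x y z, G x y z = w x y z + (l - 1) * w y x z -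
      a * ((if x = y then 1 else 0) * ∑ t, w t t z))
    (hab : (l - 1) * b = a * (l - b)) (hb : 2 * l = b * (D + 2 * l - 2)) :
    (∀ x y z, G x y z = G x z y) ∧ ∀ x, ∑ t, G x t t = 0 := by
  have hT : ∀ z, ∑ t, w t t z = (l - b) * ∑ t, v z t t := by
    intro z
    simp only [hw, Finset.sum_sub_distrib, Finset.sum_add_distrib, ht, ← Finset.mul_sum]
    have : ∑ t, v t z t = ∑ t, v z t t := Finset.sum_congr rfl fun t _ => hs _ _ _
    rw [this]
    simp
    ring
  have hG' : ∀ x y z, G x y z = l * v x y z + l * v x z y + l * (l - 1) * v y z x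
      - b * ((if y = z then 1 else 0) * ∑ t, v x t t)
      - (l - 1) * b * ((if x = z then 1 else 0) * ∑ t, v y t t)
      - (l - 1) * b * ((if x = y then 1 else 0) * ∑ t, v z t t) := by
    intro x y z
    rw [hG, hT, hw, hw, hs y x z, hab]
    ring_nf
    linear_combination (if x = z then 1 else 0) * (∑ t, v y t t) * (- hab)
  refine ⟨fun x y z => ?_, fun x => ?_⟩
  · rw [hG', hG', hs z y x]
    simp only [eq_comm (a := z) (b := y)]
    ring
  · simp only [hG', Finset.sum_sub_distrib, Finset.sum_add_distrib, ← Finset.mul_sum, ht]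
    simp
    linear_combination (∑ t, v x t t) * hb

lemma dn {D n : ℕ} (hD : 2 ≤ D) : (D : ℂ) + 2 * ((n : ℂ) + 1) - 2 ≠ 0 := by
  have : (D : ℂ) + 2 * ((n : ℂ) + 1) - 2 = ((D + 2 * n : ℕ) : ℂ) := by push_cast; ring
  rw [this]
  exact_mod_cast (by omega : D + 2 * n ≠ 0)

structure Good (D n : ℕ) : Prop where
  idem1 : symProj D (n + 1) * symProj D (n + 1) = symProj D (n + 1)
  sw : ∀ i x y j, symProj D (n + 2) (sn (sn i x) y) j = symProj D (n + 2) (sn (sn i y) x) j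
  tr : ∀ i j, ∑ t, symProj D (n + 2) (sn (sn i t) t) j = 0

lemma extendLast_one (D n : ℕ) : extendLast D n 1 = 1 := by
  refine mat_ext fun v => ?_
  funext i
  obtain ⟨i, x, rfl⟩ := exists_sn i
  rw [act_extendLast, act_one, act_one]

lemma Good.left {D n : ℕ} (h : Good D n) :
    extendLast D (n + 1) (symProj D (n + 1)) * symProj D (n + 2) = symProj D (n + 2) := by
  rw [symProj_succ, ← mul_assoc, ← mul_assoc, ← extendLast_mul, h.idem1]

lemma Good.right {D n : ℕ} (h : Good D n) :
    symProj D (n + 2) * extendLast D (n + 1) (symProj D (n + 1)) = symProj D (n + 2) := by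
  rw [symProj_succ, mul_assoc, ← extendLast_mul, h.idem1]

lemma Good.idem {D n : ℕ} (hD : 2 ≤ D) (h : Good D n) :
    symProj D (n + 2) * symProj D (n + 2) = symProj D (n + 2) := by
  have key : embAt D (n + 2) n (MStep D (n + 1)) * symProj D (n + 2) = symProj D (n + 2) := by
    ext i j
    obtain ⟨i, y, rfl⟩ := exists_sn i
    obtain ⟨i, x, rfl⟩ := exists_sn i
    rw [mul_col_apply, act_MStep hD, h.tr, h.sw i y x]
    simp only [smul_eq_mul, mul_zero, sub_zero]
    have : ((n + 1 : ℕ) : ℂ) + 1 ≠ 0 := Nat.cast_add_one_ne_zero _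
    field_simp
    ring
  conv_lhs => lhs; rw [symProj_succ]
  rw [mul_assoc, h.left, mul_assoc, key, h.left]

lemma good_zero {D : ℕ} (hD : 2 ≤ D) : Good D 0 := by
  have hD' : (D : ℂ) ≠ 0 := by
    have : D ≠ 0 := by omega
    exact_mod_cast this
  have h1 : symProj D (0 + 1) = 1 := by simp [symProj]
  have hP : ∀ i x y j, symProj D (0 + 2) (sn (sn i x) y) j =
      (((1 : ℕ) : ℂ) + 1)⁻¹ * ((1 : Matrix (Fin 2 → Fin D) (Fin 2 → Fin D) ℂ) (sn (sn i x) y) j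
        + (1 : Matrix (Fin 2 → Fin D) (Fin 2 → Fin D) ℂ) (sn (sn i y) x) j
        - bet D 1 * ((if x = y then (1 : ℂ) else 0) *
          ∑ t, (1 : Matrix (Fin 2 → Fin D) (Fin 2 → Fin D) ℂ) (sn (sn i t) t) j)) := by
    intro i x y j
    rw [symProj_succ, h1, extendLast_one, one_mul]
    rw [mul_col_apply, act_MStep hD]
    simp
  refine ⟨by rw [h1, one_mul], fun i x y j => ?_, fun i j => ?_⟩
  · rw [hP, hP]
    simp only [eq_comm (a := y) (b := x)]
    ring
  · simp only [hP, ← Finset.mul_sum, Finset.sum_sub_distrib, Finset.sum_add_distrib]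
    simp [bet]
    field_simp
    ring

lemma good_succ {D n : ℕ} (hD : 2 ≤ D) (h : Good D n) : Good D (n + 1) := by
  have hQ : symProj D (n + 1 + 2) = extendLast D (n + 2) (extendLast D (n + 1) (symProj D (n + 1)))
      * (extendLast D (n + 2) (embAt D (n + 2) n (MStep D (n + 1)))
      * (embAt D (n + 3) (n + 1) (MStep D (n + 2)) * extendLast D (n + 2) (symProj D (n + 2)))) := by
    rw [symProj_succ D (n + 1)]
    conv_lhs => lhs; lhs; rw [symProj_succ, extendLast_mul, extendLast_mul]
    simp only [mul_assoc]
    rw [← mul_assoc (extendLast D (n + 1 + 1) (extendLast D (n + 1) (symProj D (n + 1))))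
      (embAt D (n + 1 + 2) (n + 1) (MStep D (n + 1 + 1))), ext_comm, mul_assoc,
      ← extendLast_mul, h.left]
  have main : ∀ (i : Fin n → Fin D) (j : Fin (n + 3) → Fin D),
      let G := fun x y z => act (extendLast D (n + 2) (embAt D (n + 2) n (MStep D (n + 1))))
        (act (embAt D (n + 3) (n + 1) (MStep D (n + 2)))
          (fun k => extendLast D (n + 2) (symProj D (n + 2)) k j)) (sn (sn (sn i x) y) z)
      (∀ x y z, G x y z = G x z y) ∧ ∀ x, ∑ t, G x t t = 0 := by
    intro i j G
    have hd := dn (n := n) hD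
    have hd2 := dn (n := n + 1) hD
    push_cast at hd2
    have hc1 : ((n + 1 : ℕ) : ℂ) + 1 ≠ 0 := Nat.cast_add_one_ne_zero _
    have hc2 : ((n + 2 : ℕ) : ℂ) + 1 ≠ 0 := Nat.cast_add_one_ne_zero _
    have := three_strand (D := D) (((n + 2 : ℕ) : ℂ)) (bet D (n + 1)) (bet D (n + 2))
      (fun x y z => extendLast D (n + 2) (symProj D (n + 2)) (sn (sn (sn i x) y) z) j)
      (fun x y z => (((n + 1 : ℕ) : ℂ) + 1) * ((((n + 2 : ℕ) : ℂ) + 1) * G x y z))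
      (fun x y z => by simp only [extendLast, sn_castSucc, sn_last]; rw [h.sw])
      (fun z => by
        simp only [extendLast, sn_castSucc, sn_last, ← Finset.sum_mul]; rw [h.tr, zero_mul])
      (fun x y z => (((n + 2 : ℕ) : ℂ) + 1) * act (embAt D (n + 3) (n + 1) (MStep D (n + 2)))
          (fun k => extendLast D (n + 2) (symProj D (n + 2)) k j) (sn (sn (sn i x) y) z))
      (fun x y z => by
        rw [act_MStep hD, smul_eq_mul, mul_inv_cancel_left₀ hc2]
        simp only [smul_eq_mul])
      (fun x y z => by
        simp only [G]
        rw [act_extendLast, act_MStep hD, smul_eq_mul, ← Finset.mul_sum]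
        simp only [smul_eq_mul]
        rw [mul_left_comm, mul_inv_cancel_left₀ hc1]
        push_cast
        ring)
      (by
        have e1 : (D : ℂ) + 2 * (n + 2) - 2 ≠ 0 := by convert hd2 using 2; ring
        simp only [bet]
        push_cast
        field_simp
        ring)
      (by
        have e1 : (D : ℂ) + 2 * (n + 2) - 2 ≠ 0 := by convert hd2 using 2; ring
        simp only [bet]
        push_cast
        field_simp)
    obtain ⟨t1, t2⟩ := this
    refine ⟨fun x y z => ?_, fun x => ?_⟩
    · exact mul_left_cancel₀ hc2 (mul_left_cancel₀ hc1 (t1 x y z))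
    · have := t2 x
      rw [← Finset.mul_sum, ← Finset.mul_sum] at this
      exact (mul_eq_zero.1 ((mul_eq_zero.1 this).resolve_left hc1)).resolve_left hc2
  have hcol : ∀ i y z j, symProj D (n + 1 + 2) (sn (sn i y) z) j =
      ∑ k, symProj D (n + 1) i k *
        act (extendLast D (n + 2) (embAt D (n + 2) n (MStep D (n + 1))))
        (act (embAt D (n + 3) (n + 1) (MStep D (n + 2)))
          (fun k => extendLast D (n + 2) (symProj D (n + 2)) k j)) (sn (sn k y) z) := by
    intro i y z j
    rw [hQ]
    rw [mul_col_apply, mul_col, mul_col, act_extendLast, act_extendLast]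
    rfl
  refine ⟨h.idem hD, fun i y z j => ?_, fun i j => ?_⟩
  · rw [hcol, hcol]
    refine Finset.sum_congr rfl fun k _ => ?_
    obtain ⟨k, x, rfl⟩ := exists_sn k
    exact congrArg _ ((main k j).1 x y z)
  · simp only [hcol]
    rw [Finset.sum_comm]
    refine Finset.sum_eq_zero fun k _ => ?_
    obtain ⟨k, x, rfl⟩ := exists_sn k
    rw [← Finset.mul_sum]
    exact mul_eq_zero_of_right _ ((main k j).2 x)

lemma good {D : ℕ} (hD : 2 ≤ D) (n : ℕ) : Good D n := by
  induction n with
  | zero => exact good_zero hD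
  | succ n ih => exact good_succ hD ih

/-- Row symmetry under adjacent transpositions. -/
lemma symm_adj {D : ℕ} (hD : 2 ≤ D) (n : ℕ) : ∀ (k : Fin n) (i j : Fin (n + 1) → Fin D),
    symProj D (n + 1) (i ∘ Equiv.swap k.castSucc k.succ) j = symProj D (n + 1) i j := by
  induction n with
  | zero => intro k; exact k.elim0
  | succ n ih =>
    intro k i j
    obtain ⟨i, y, rfl⟩ := exists_sn i
    refine Fin.lastCases ?_ (fun k => ?_) k
    · obtain ⟨i, x, rfl⟩ := exists_sn i
      have : sn (sn i x) y ∘ Equiv.swap (Fin.last n).castSucc (Fin.last n).succ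
          = sn (sn i y) x := by
        funext m
        refine Fin.lastCases ?_ (fun m => ?_) m
        · have : Fin.last (n + 1) = (Fin.last n).succ := rfl
          rw [Function.comp, this, Equiv.swap_apply_right, ← this]
          simp
        · refine Fin.lastCases ?_ (fun m => ?_) m
          · rw [Function.comp, Equiv.swap_apply_left]
            simp
          · rw [Function.comp, Equiv.swap_apply_of_ne_of_ne]
            · simp
            · simp [Fin.ext_iff]; omega
            · simp [Fin.ext_iff]; omega
      rw [this, (good hD n).sw]
    · have : sn i y ∘ Equiv.swap k.castSucc.castSucc k.castSucc.succ
          = sn (i ∘ Equiv.swap k.castSucc k.succ) y := by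
        funext m
        refine Fin.lastCases ?_ (fun m => ?_) m
        · rw [Function.comp, Equiv.swap_apply_of_ne_of_ne]
          · simp
          · simp [Fin.ext_iff]; omega
          · simp [Fin.ext_iff]; omega
        · have e : Equiv.swap k.castSucc.castSucc k.castSucc.succ m.castSucc
            = (Equiv.swap k.castSucc k.succ m).castSucc := by
            rw [Fin.succ_castSucc]
            simp only [Equiv.swap_apply_def, Fin.castSucc_inj]
            split_ifs <;> rfl
          simp [e]
      rw [this, ← (good hD n).left]
      rw [mul_col_apply, mul_col_apply, act_extendLast, act_extendLast]
      simp only [act, ih]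

lemma symm_perm {D : ℕ} (hD : 2 ≤ D) (n : ℕ) (σ : Equiv.Perm (Fin (n + 1)))
    (i j : Fin (n + 1) → Fin D) :
    symProj D (n + 1) (i ∘ σ) j = symProj D (n + 1) i j := by
  have hσ : σ ∈ Submonoid.closure (Set.range fun k : Fin n => Equiv.swap k.castSucc k.succ) := by
    rw [Equiv.Perm.mclosure_swap_castSucc_succ]; trivial
  induction hσ using Submonoid.closure_induction generalizing i with
  | mem x hx => obtain ⟨k, rfl⟩ := hx; exact symm_adj hD n k i j
  | one => rfl
  | mul x y _ _ hx hy =>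
    rw [Equiv.Perm.coe_mul, ← Function.comp_assoc, hy, hx]

lemma harm_cons {D : ℕ} (hD : 2 ≤ D) (n : ℕ) (h : Fin D) (i : Fin n → Fin D) :
    harmX D (n + 1) (Fin.cons h i) = harmX D (n + 1) (sn i h) := by
  have : sn i h = (Fin.cons h i : Fin (n + 1) → Fin D) ∘ finRotate (n + 1) := by
    funext m
    refine Fin.lastCases ?_ (fun m => ?_) m
    · simp
    · simp [Fin.coeSucc_eq_succ]
  unfold harmX
  simp only [this, symm_perm hD]

/-- The tensor `x ⊗ … ⊗ x`. -/
def mon (D n : ℕ) (j : Fin n → Fin D) : Poly D := ∏ m : Fin n, X (j m)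

lemma harm_act (D n : ℕ) : harmX D n = act (symProj D n) (mon D n) := rfl

lemma mon_sn {D n : ℕ} (j : Fin n → Fin D) (x : Fin D) : mon D (n + 1) (sn j x) =
    mon D n j * X x := by
  simp [mon, Fin.prod_univ_castSucc]

lemma act_mul_right {I : Type*} [Fintype I] {D : ℕ} (A : Matrix I I ℂ) (v : I → Poly D)
    (p : Poly D) (i : I) : act A (fun k => v k * p) i = act A v i * p := by
  simp [act, Finset.sum_mul]

lemma act_ext_mon {D n : ℕ} (i : Fin n → Fin D) (x : Fin D) :
    act (extendLast D n (symProj D n)) (mon D (n + 1)) (sn i x) = harmX D n i * X x := by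
  rw [act_extendLast]
  simp only [mon_sn]
  rw [act_mul_right]; rfl

/-- `𝒫^{l}` applied to `X_{l-1} ⊗ x` gives `X_l`. -/
lemma act_harm_X {D : ℕ} (hD : 2 ≤ D) (n : ℕ) :
    act (symProj D (n + 1)) (act (extendLast D n (symProj D n)) (mon D (n + 1)))
      = harmX D (n + 1) := by
  rw [← act_mul, harm_act]
  cases n with
  | zero =>
    have : symProj D 0 = 1 := by simp [symProj]
    rw [this, extendLast_one, mul_one]
  | succ n => rw [(good hD n).right]

def cc (D : ℕ) : ℕ → ℂ
  | 0 => 1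
  | (n + 1) => ((n : ℂ) + 2)⁻¹ * (1 + ((n : ℂ) + 1) * cc D n * (1 - bet D (n + 1) / (n + 1)))

lemma act_lin {I V : Type*} [Fintype I] [AddCommGroup V] [Module ℂ V] (A : Matrix I I ℂ)
    (c d : ℂ) (v w : I → V) :
    act A (fun k => c • v k + d • w k) = fun i => c • act A v i + d • act A w i := by
  funext i
  simp only [act, smul_add, Finset.sum_add_distrib, Finset.smul_sum, smul_comm (A i _)]

lemma contract {D : ℕ} (hD : 2 ≤ D) (n : ℕ) : ∀ (i : Fin n → Fin D),
    ∑ h, harmX D (n + 1) (sn i h) * X h = cc D n • (harmX D n i * r2 D) := by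
  induction n with
  | zero =>
    intro i
    have h0 : symProj D 0 = 1 := by simp [symProj]
    have h1 : symProj D (0 + 1) = 1 := by simp [symProj]
    rw [harm_act, harm_act, h0, h1, act_one, act_one]
    simp only [mon_sn]
    simp [mon, cc, r2]
  | succ n ih =>
    intro i
    have key : ∀ (k : Fin (n + 1) → Fin D),
        ∑ h, act (embAt D (n + 2) n (MStep D (n + 1)))
          (act (extendLast D (n + 1) (symProj D (n + 1))) (mon D (n + 2))) (sn k h) * X h
        = (((n : ℂ) + 2)⁻¹) • (harmX D (n + 1) k * r2 D) +
          (((n : ℂ) + 2)⁻¹ * (((n : ℂ) + 1) * cc D n * (1 - bet D (n + 1) / (n + 1)))) •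
          (act (extendLast D n (symProj D n)) (mon D (n + 1)) k * r2 D) := by
      intro k
      obtain ⟨k, x, rfl⟩ := exists_sn k
      have hn : (n : ℂ) + 1 ≠ 0 := Nat.cast_add_one_ne_zero _
      simp only [act_MStep hD, act_ext_mon, ih]
      have e1 : ∑ h : Fin D, harmX D (n + 1) (sn k x) * X h * X h
          = harmX D (n + 1) (sn k x) * r2 D := by
        simp [r2, Finset.mul_sum, mul_assoc]
      have e2 : ∑ h : Fin D, harmX D (n + 1) (sn k h) * X x * X h
          = cc D n • (harmX D n k * X x * r2 D) := by
        have := congrArg (fun p => p * X x) (ih k)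
        simp only [Finset.sum_mul] at this
        rw [Finset.sum_congr rfl (fun h _ => mul_right_comm _ _ _), this, smul_mul_assoc,
          mul_right_comm]
      have e3 : ∑ h : Fin D, ((if x = h then (1 : ℂ) else 0) • cc D n • (harmX D n k * r2 D)) * X h
          = cc D n • (harmX D n k * X x * r2 D) := by
        rw [Finset.sum_eq_single x]
        · simp [mul_right_comm]
        · intro b _ hb
          simp [Ne.symm hb]
        · simp
      simp only [smul_mul_assoc, add_mul, sub_mul, ← Finset.smul_sum, Finset.sum_add_distrib,
        Finset.sum_sub_distrib, smul_add, smul_sub] at e1 e2 e3 ⊢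
      rw [e1, e2, e3]
      push_cast
      have e4 : (n : ℂ) + 1 + 1 = n + 2 := by ring
      rw [e4]
      simp only [smul_smul]
      rw [add_sub_assoc, ← sub_smul]
      congr 2
      field_simp
    have : ∀ h, harmX D (n + 2) (sn i h) = act (symProj D (n + 1)) (fun k =>
        act (embAt D (n + 2) n (MStep D (n + 1)))
          (act (extendLast D (n + 1) (symProj D (n + 1))) (mon D (n + 2))) (sn k h)) i := by
      intro h
      rw [harm_act, symProj_succ, act_mul, act_mul, act_extendLast]
    have h2 : ∑ h, harmX D (n + 2) (sn i h) * X h = act (symProj D (n + 1)) (fun k =>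
        ∑ h, act (embAt D (n + 2) n (MStep D (n + 1)))
          (act (extendLast D (n + 1) (symProj D (n + 1))) (mon D (n + 2))) (sn k h) * X h) i := by
      simp only [this, ← act_mul_right]
      simp only [act, Finset.smul_sum]
      exact Finset.sum_comm
    rw [h2]
    simp only [key]
    rw [act_lin]
    simp only []
    rw [act_mul_right, act_mul_right, act_harm_X hD]
    have idem : act (symProj D (n + 1)) (harmX D (n + 1)) = harmX D (n + 1) := by
      rw [harm_act, ← act_mul, (good hD n).idem1]
    rw [idem, ← add_smul, cc]
    congr 1
    ring

lemma cc_eq {D : ℕ} (hD : 2 ≤ D) (n : ℕ) :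
    cc D n * ((D : ℂ) + 2 * n - 2) = (D : ℂ) + n - 2 := by
  induction n with
  | zero => simp [cc]
  | succ n ih =>
    have hd := dn (n := n) hD
    have hn : (n : ℂ) + 1 ≠ 0 := Nat.cast_add_one_ne_zero _
    have hn2 : (n : ℂ) + 2 ≠ 0 := by
      have := Nat.cast_add_one_ne_zero (R := ℂ) (n + 1)
      push_cast at this
      convert this using 1
      ring
    have e : ((n : ℂ) + 1) * cc D n * (1 - bet D (n + 1) / (n + 1)) =
      (n + 1) * (D + n - 2) / ((D : ℂ) + 2 * (n + 1) - 2) := by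
      rw [← ih, bet]
      push_cast
      have hA : (D : ℂ) = ((D : ℂ) + 2 * (n + 1) - 2) - 2 * n := by ring
      generalize (D : ℂ) + 2 * (n + 1) - 2 = A at *
      rw [hA]
      field_simp
      ring
    rw [cc, e]
    push_cast
    field_simp
    ring

theorem statement5 (D : ℕ) (hD : 2 ≤ D) (m : ℕ) (hexc : ¬(D = 2 ∧ m = 0))
    (i : Fin m → Fin D) :
    ∑ h : Fin D, X h * harmX D (m + 1) (Fin.cons h i) =
      ((((D : ℂ) + 2 * ((m : ℂ) + 1) - 2)⁻¹ *
          ((D : ℂ) + ((m : ℂ) + 1) - 1 -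
            (2 * ((m : ℂ) + 1) - 2) / ((D : ℂ) + 2 * ((m : ℂ) + 1) - 4)))) •
        (r2 D * harmX D m i) := by
  simp only [harm_cons hD, mul_comm (X _)]
  rw [contract hD, mul_comm (r2 D)]
  congr 1
  have hd := dn (n := m) hD
  have h0 : (D : ℂ) + 2 * ((m : ℂ) + 1) - 4 ≠ 0 := by
    intro h
    have h' : ((D + 2 * m : ℕ) : ℂ) = ((2 : ℕ) : ℂ) := by
      push_cast
      linear_combination h
    have : D + 2 * m = 2 := by exact_mod_cast h'
    omega
  have hc := cc_eq hD m
  have h0' : (D : ℂ) + 2 * (m : ℂ) - 2 ≠ 0 := by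
    intro h; apply h0; linear_combination h
  rw [← mul_left_inj' h0', hc]
  have e : (D : ℂ) + 2 * ((m : ℂ) + 1) - 4 = (D : ℂ) + 2 * (m : ℂ) - 2 := by ring
  rw [e]
  have hA : (D : ℂ) = ((D : ℂ) + 2 * m - 2) - 2 * m + 2 := by ring
  have e' : (D : ℂ) + 2 * ((m : ℂ) + 1) - 2 = ((D : ℂ) + 2 * m - 2) + 2 := by ring
  rw [e'] at hd ⊢
  generalize (D : ℂ) + 2 * m - 2 = A at *
  rw [hA]
  field_simp
  ring

end Fuzzy
end
end

section
/- For every l ≥ 1, all h,k ∈ {1,…,D} and all indices i_1,…,i_l ∈ {1,…,D}: iL_{hk} X_l^{i_1…i_l} = l·(ζ_{l+2}/ζ_{l+1})·(𝒫^{l+1}{}^{h i_1…i_l}_{k j_1…j_l} − 𝒫^{l+1}{}^{k i_1…i_l}_{h j_1…j_l})·X_l^{j_1…j_l} = l·𝒫^l{}^{i_1…i_l}_{j_1…j_l}·(δ^{k j_1} X_l^{h j_2…j_l} − δ^{h j_1} X_l^{k j_2…j_l}), where ζ_{l+1} := Dl/(D+2l−2) and sums run over the repeated j-indices. -/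
open scoped BigOperators

noncomputable section
namespace Fuzzy

/-- `ζ_{l+1} = D·l/(D+2l−2)`. -/
def zetaSucc (D l : ℕ) : ℂ := (D : ℂ) * (l : ℂ) / ((D : ℂ) + 2 * (l : ℂ) - 2)

section helpers
open MvPolynomial

lemma pd_comm {D : ℕ} (a b : Fin D) (φ : Poly D) :
    pderiv a (pderiv b φ) = pderiv b (pderiv a φ) := by
  have h : ⁅(pderiv a : Derivation ℂ (Poly D) (Poly D)), (pderiv b : Derivation ℂ (Poly D) (Poly D))⁆ = 0 := by
    apply MvPolynomial.derivation_ext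
    intro i
    rw [Derivation.commutator_apply]
    classical
    simp only [pderiv_X, Pi.single_apply]
    split_ifs <;> simp
  have := congrArg (fun d => d φ) h
  simp only [Derivation.commutator_apply, Derivation.zero_apply] at this
  exact sub_eq_zero.mp this

/-- The harmonic raising step. -/
def stepL (D l : ℕ) (e : Fin D) : Poly D →ₗ[ℂ] Poly D :=
  LinearMap.mulLeft ℂ (X e) -
    ((D : ℂ) + 2 * (l : ℂ) - 2)⁻¹ •
      ((LinearMap.mulLeft ℂ (r2 D)) ∘ₗ (pderiv e : Derivation ℂ (Poly D) (Poly D)).toLinearMap)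

lemma stepL_apply (D l : ℕ) (e : Fin D) (g : Poly D) :
    stepL D l e g = X e * g - C (((D : ℂ) + 2 * (l : ℂ) - 2)⁻¹) * (r2 D * pderiv e g) := by
  simp [stepL, smul_eq_C_mul]

/-- Harmonic polynomials built recursively. -/
def GG (D : ℕ) : (l : ℕ) → (Fin l → Fin D) → Poly D
  | 0, _ => 1
  | (l + 1), i => stepL D l (i (Fin.last l)) (GG D l (Fin.init i))

/-- Iterated derivatives. -/
def dd (D : ℕ) : (l : ℕ) → (Fin l → Fin D) → Poly D →ₗ[ℂ] Poly D
  | 0, _ => LinearMap.id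
  | (l + 1), i =>
    dd D l (Fin.init i) ∘ₗ (pderiv (i (Fin.last l)) : Derivation ℂ (Poly D) (Poly D)).toLinearMap

lemma GG_snoc (D l : ℕ) (i : Fin l → Fin D) (a : Fin D) :
    GG D (l + 1) (Fin.snoc (α := fun _ => Fin D) i a) = stepL D l a (GG D l i) := by
  simp [GG]

lemma dd_snoc (D l : ℕ) (i : Fin l → Fin D) (a : Fin D) (φ : Poly D) :
    dd D (l + 1) (Fin.snoc (α := fun _ => Fin D) i a) φ = dd D l i (pderiv a φ) := by
  simp [dd]

lemma dd_cons (D l : ℕ) (i : Fin l → Fin D) (a : Fin D) (φ : Poly D) :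
    dd D (l + 1) (Fin.cons (α := fun _ => Fin D) a i) φ = dd D l i (pderiv a φ) := by
  induction l generalizing φ with
  | zero =>
    simp only [dd, LinearMap.comp_apply, LinearMap.id_apply]
    rfl
  | succ l ih =>
    obtain ⟨j, b, rfl⟩ : ∃ (j : Fin l → Fin D) (b : Fin D), i = Fin.snoc (α := fun _ => Fin D) j b :=
      ⟨Fin.init i, i (Fin.last l), (Fin.snoc_init_self (α := fun _ => Fin D) i).symm⟩
    rw [Fin.cons_snoc_eq_snoc_cons, dd_snoc, ih, dd_snoc, pd_comm]

lemma sum_snoc {D l : ℕ} {A : Type*} [AddCommMonoid A] (f : (Fin (l + 1) → Fin D) → A) :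
    ∑ j, f j = ∑ b : Fin D, ∑ j : Fin l → Fin D, f (Fin.snoc (α := fun _ => Fin D) j b) := by
  rw [← Fintype.sum_prod_type' (f := fun b j => f (Fin.snoc (α := fun _ => Fin D) j b))]
  exact (Equiv.sum_comp (Fin.snocEquiv (fun _ : Fin (l + 1) => Fin D)) f).symm

lemma sum_cons {D l : ℕ} {A : Type*} [AddCommMonoid A] (f : (Fin (l + 1) → Fin D) → A) :
    ∑ j, f j = ∑ b : Fin D, ∑ j : Fin l → Fin D, f (Fin.cons (α := fun _ => Fin D) b j) := by
  rw [← Fintype.sum_prod_type' (f := fun b j => f (Fin.cons (α := fun _ => Fin D) b j))]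
  exact (Equiv.sum_comp (Fin.consEquiv (fun _ : Fin (l + 1) => Fin D)) f).symm

lemma r2_hom (D : ℕ) : (r2 D).IsHomogeneous 2 := by
  unfold r2
  exact IsHomogeneous.sum _ _ _ fun i _ => (isHomogeneous_X ℂ i).mul (isHomogeneous_X ℂ i)

lemma pd_hom0 {D : ℕ} {g : Poly D} (hg : g.IsHomogeneous 0) (e : Fin D) : pderiv e g = 0 := by
  rw [← totalDegree_zero_iff_isHomogeneous, totalDegree_eq_zero_iff_eq_C] at hg
  rw [hg, pderiv_C]

lemma step_hom {D l : ℕ} {g : Poly D} (hg : g.IsHomogeneous l) (e : Fin D) :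
    (stepL D l e g).IsHomogeneous (l + 1) := by
  rw [stepL_apply]
  apply IsHomogeneous.sub
  · rw [add_comm]; exact (isHomogeneous_X ℂ e).mul hg
  · rcases l with _ | l
    · rw [pd_hom0 hg]; simp [isHomogeneous_zero]
    · have h1 : (pderiv e g).IsHomogeneous l := hg.pderiv
      have := (isHomogeneous_C (Fin D) (((D : ℂ) + 2 * ((l + 1 : ℕ) : ℂ) - 2)⁻¹)).mul ((r2_hom D).mul h1)
      rw [show 0 + (2 + l) = l + 1 + 1 by omega] at this
      exact this

lemma GG_hom (D l : ℕ) (i : Fin l → Fin D) : (GG D l i).IsHomogeneous l := by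
  induction l with
  | zero => exact isHomogeneous_one _ _
  | succ l ih => exact step_hom (ih _) _

lemma C_two (D : ℕ) : (C 2 : Poly D) = 2 := map_ofNat C 2

lemma pd_r2 {D : ℕ} (e : Fin D) : pderiv e (r2 D) = 2 * X e := by
  classical
  simp only [r2, map_sum, pderiv_mul, pderiv_X, Pi.single_apply]
  simp [Finset.sum_add_distrib, two_mul]

lemma lap_mul {D : ℕ} (f g : Poly D) :
    lap (f * g) = lap f * g + 2 * ∑ i, pderiv i f * pderiv i g + f * lap g := by
  simp only [lap, Finset.sum_mul, Finset.mul_sum, ← Finset.sum_add_distrib]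
  refine Finset.sum_congr rfl fun i _ => ?_
  simp only [pderiv_mul, map_add]
  ring

lemma lap_X {D : ℕ} (e : Fin D) : lap (X e : Poly D) = 0 := by
  classical
  simp only [lap]
  refine Finset.sum_eq_zero fun i _ => ?_
  simp only [pderiv_X, Pi.single_apply]
  split_ifs <;> simp

lemma lap_r2 {D : ℕ} : lap (r2 D) = 2 * (D : Poly D) := by
  simp only [lap, pd_r2, ← C_two, pderiv_C_mul, pderiv_X_self]
  simp [mul_comm]

lemma lap_pd {D : ℕ} (e : Fin D) (g : Poly D) : lap (pderiv e g) = pderiv e (lap g) := by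
  simp only [lap, map_sum]
  refine Finset.sum_congr rfl fun i _ => ?_
  rw [pd_comm i e, pd_comm i e]

lemma lap_C_mul {D : ℕ} (c : ℂ) (g : Poly D) : lap (C c * g) = C c * lap g := by
  simp only [lap, pderiv_C_mul, Finset.mul_sum]

lemma lap_sub {D : ℕ} (f g : Poly D) : lap (f - g) = lap f - lap g := by
  simp only [lap, map_sub, Finset.sum_sub_distrib]

lemma den_ne (D : ℕ) (hD : 2 ≤ D) (l : ℕ) : ((D : ℂ) + 2 * ((l + 1 : ℕ) : ℂ) - 2) ≠ 0 := by
  have : ((D : ℂ) + 2 * ((l + 1 : ℕ) : ℂ) - 2) = ((D + 2 * l : ℕ) : ℂ) := by push_cast; ring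
  rw [this]
  exact_mod_cast (by omega : D + 2 * l ≠ 0)

lemma step_lap {D : ℕ} (hD : 2 ≤ D) {l : ℕ} {g : Poly D} (hg : g.IsHomogeneous l) (hl : lap g = 0)
    (e : Fin D) : lap (stepL D l e g) = 0 := by
  classical
  have h1 : lap (X e * g) = 2 * pderiv e g := by
    rw [lap_mul, lap_X, hl]
    simp [pderiv_X, Pi.single_apply]
  rw [stepL_apply, lap_sub, lap_C_mul, h1]
  rcases l with _ | l
  · rw [pd_hom0 hg]; simp [lap]
  · have h2 : (pderiv e g).IsHomogeneous l := hg.pderiv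
    have h3 := h2.sum_X_mul_pderiv
    have h4 : lap (r2 D * pderiv e g) = C (2 * ((D : ℂ) + 2 * ((l + 1 : ℕ) : ℂ) - 2)) * pderiv e g := by
      rw [lap_mul, lap_r2, lap_pd, hl]
      simp only [pd_r2, mul_assoc, ← Finset.mul_sum, h3]
      simp [C_two]
      ring
    rw [h4, ← mul_assoc, ← C_mul]
    have := den_ne D hD l
    rw [show (((D : ℂ) + 2 * ((l + 1 : ℕ) : ℂ) - 2)⁻¹ * (2 * ((D : ℂ) + 2 * ((l + 1 : ℕ) : ℂ) - 2))) = 2 by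
      field_simp, C_two, sub_self]

lemma GG_lap (D : ℕ) (hD : 2 ≤ D) (l : ℕ) (i : Fin l → Fin D) : lap (GG D l i) = 0 := by
  induction l with
  | zero => simp [GG, lap]
  | succ l ih => exact step_lap hD (GG_hom _ _ _) (ih _) _

lemma hom0_eq {D : ℕ} {g : Poly D} (hg : g.IsHomogeneous 0) : C (constantCoeff g) = g := by
  rw [← totalDegree_zero_iff_isHomogeneous, totalDegree_eq_zero_iff_eq_C] at hg
  rw [hg]; simp

/-- Sum of steps on the gradient. -/
lemma sum_step_pd {D l : ℕ} {g : Poly D} (hg : g.IsHomogeneous (l + 1)) (hl : lap g = 0) :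
    ∑ e, stepL D l e (pderiv e g) = C ((l : ℂ) + 1) * g := by
  simp only [stepL_apply, Finset.sum_sub_distrib, ← Finset.mul_sum]
  rw [hg.sum_X_mul_pderiv]
  change _ - _ * (_ * lap g) = _
  rw [hl]
  simp

lemma repro {D : ℕ} {l : ℕ} {g : Poly D} (hg : g.IsHomogeneous l) (hl : lap g = 0) :
    ∑ j, constantCoeff (dd D l j g) • GG D l j = (l.factorial : ℂ) • g := by
  induction l generalizing g with
  | zero =>
    simp [dd, GG, smul_eq_C_mul, hom0_eq hg]
  | succ l ih =>
    rw [sum_snoc]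
    simp only [dd_snoc, GG_snoc, ← map_smul, ← map_sum]
    have : ∀ b, ∑ j, constantCoeff (dd D l j (pderiv b g)) • GG D l j =
        (l.factorial : ℂ) • pderiv b g := fun b =>
      ih (hg.pderiv) (by rw [lap_pd, hl, map_zero])
    simp only [this, map_smul, ← Finset.smul_sum]
    rw [sum_step_pd hg hl, ← smul_eq_C_mul, smul_smul, Nat.factorial_succ]
    push_cast
    ring_nf

lemma taylor {D : ℕ} {l : ℕ} {g : Poly D} (hg : g.IsHomogeneous l) :
    ∑ j, constantCoeff (dd D l j g) • (∏ m : Fin l, X (j m) : Poly D) = (l.factorial : ℂ) • g := by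
  induction l generalizing g with
  | zero =>
    simp [dd, smul_eq_C_mul, hom0_eq hg]
  | succ l ih =>
    rw [sum_snoc]
    simp only [dd_snoc, Fin.prod_univ_castSucc, Fin.snoc_castSucc, Fin.snoc_last, ← smul_mul_assoc,
      ← Finset.sum_mul]
    have : ∀ b, ∑ j, constantCoeff (dd D l j (pderiv b g)) • (∏ m : Fin l, X (j m) : Poly D) =
        (l.factorial : ℂ) • pderiv b g := fun b => ih (hg.pderiv)
    simp only [this, smul_mul_assoc, ← Finset.smul_sum]
    simp only [mul_comm _ (X _)]
    rw [hg.sum_X_mul_pderiv, Nat.factorial_succ]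
    simp only [smul_eq_C_mul, nsmul_eq_mul]
    push_cast
    simp
    ring

lemma emb_entry (D l : ℕ) (A : PairMat D) (p q : Fin l → Fin D) (e a f b : Fin D) :
    embAt D (l + 2) l A
      (Fin.snoc (α := fun _ => Fin D) (Fin.snoc (α := fun _ => Fin D) p e) a)
      (Fin.snoc (α := fun _ => Fin D) (Fin.snoc (α := fun _ => Fin D) q f) b) =
    if p = q then A (e, a) (f, b) else 0 := by
  have h1 : (⟨l + 1, by omega⟩ : Fin (l + 2)) = Fin.last (l + 1) := rfl
  have h2 : (⟨l, by omega⟩ : Fin (l + 2)) = (Fin.last l).castSucc := rfl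
  unfold embAt
  rw [dif_pos (by omega), h1, h2]
  simp only [Fin.snoc_last, Fin.snoc_castSucc, Fin.prod_univ_castSucc, Fin.val_castSucc,
    Fin.val_last]
  have h3 : ∀ x : Fin l, ¬ (x.val = l ∨ x.val = l + 1) := fun x => by omega
  simp only [h3, if_false]
  simp only [true_or, or_true, if_true, mul_one]
  by_cases hpq : p = q
  · simp [hpq]
  · obtain ⟨x, hx⟩ := Function.ne_iff.mp hpq
    rw [if_neg hpq, Finset.prod_eq_zero (Finset.mem_univ x) (by simp [hx]), mul_zero]

lemma ext_entry (D l : ℕ) (A : Matrix (Fin l → Fin D) (Fin l → Fin D) ℂ) (p q : Fin l → Fin D)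
    (a b : Fin D) :
    extendLast D l A (Fin.snoc (α := fun _ => Fin D) p a) (Fin.snoc (α := fun _ => Fin D) q b) =
    if a = b then A p q else 0 := by
  simp [extendLast]

lemma sp_succ (D l : ℕ) (i j : Fin (l + 1) → Fin D) (a b : Fin D) :
    symProj D (l + 2) (Fin.snoc (α := fun _ => Fin D) i a) (Fin.snoc (α := fun _ => Fin D) j b) =
    ∑ e : Fin D, ∑ f : Fin D, MStep D (l + 1) (e, a) (f, b) * ∑ p : Fin l → Fin D,
      symProj D (l + 1) i (Fin.snoc (α := fun _ => Fin D) p e) *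
       symProj D (l + 1) (Fin.snoc (α := fun _ => Fin D) p f) j := by
  have hs : symProj D (l + 2) = extendLast D (l + 1) (symProj D (l + 1)) *
    embAt D (l + 2) l (MStep D (l + 1)) * extendLast D (l + 1) (symProj D (l + 1)) := rfl
  rw [hs, mul_assoc, Matrix.mul_apply, sum_snoc]
  simp only [ext_entry, ite_mul, zero_mul]
  rw [Finset.sum_comm]
  simp only [Finset.sum_ite_eq, Finset.mem_univ, if_true]
  rw [sum_snoc]
  refine Finset.sum_congr rfl fun e _ => ?_
  simp only [Finset.mul_sum]
  rw [Finset.sum_comm]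
  refine Finset.sum_congr rfl fun p _ => ?_
  rw [Matrix.mul_apply, sum_snoc]
  simp only [ext_entry, mul_ite, mul_zero]
  rw [Finset.sum_comm]
  simp only [Finset.sum_ite_eq', Finset.mem_univ, if_true]
  rw [sum_snoc, Finset.mul_sum]
  refine Finset.sum_congr rfl fun f _ => ?_
  simp only [emb_entry, ite_mul, zero_mul, Finset.sum_ite_eq, Finset.mem_univ, if_true]
  ring

lemma M_entry (D l : ℕ) (hD : D ≠ 0) (e a f b : Fin D) :
    MStep D l (e, a) (f, b) = ((l : ℂ) + 1)⁻¹ * ((if e = f then 1 else 0) * (if a = b then 1 else 0)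
      + (l : ℂ) * ((if e = b then 1 else 0) * (if a = f then 1 else 0))
      - 2 * (l : ℂ) * ((D : ℂ) + 2 * (l : ℂ) - 2)⁻¹ *
        ((if e = a then 1 else 0) * (if f = b then 1 else 0))) := by
  have : (D : ℂ) ≠ 0 := by exact_mod_cast hD
  have h1 : (1 : PairMat D) (e, a) (f, b) =
      (if e = f then 1 else 0) * (if a = b then 1 else 0) := by
    rw [Matrix.one_apply]; simp only [Prod.mk.injEq]; split_ifs <;> simp_all
  simp only [MStep, Matrix.smul_apply, Matrix.sub_apply, Matrix.add_apply, smul_eq_mul, h1,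
    flipMat, traceMat, ite_and]
  congr 1
  congr 1
  · congr 2
    split_ifs <;> simp
  · generalize (D : ℂ) + 2 * (l : ℂ) - 2 = s
    rw [div_eq_mul_inv]
    field_simp

lemma sp_symm (D : ℕ) (hD : D ≠ 0) (l : ℕ) (i j : Fin l → Fin D) :
    symProj D l i j = symProj D l j i := by
  induction l with
  | zero => simp [symProj, Matrix.one_apply, eq_comm]
  | succ l ih =>
    rcases l with _ | l
    · simp [symProj, Matrix.one_apply, eq_comm]
    · rw [← Fin.snoc_init_self (α := fun _ => Fin D) i, ← Fin.snoc_init_self (α := fun _ => Fin D) j,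
        sp_succ, sp_succ, Finset.sum_comm]
      refine Finset.sum_congr rfl fun e _ => Finset.sum_congr rfl fun f _ => ?_
      congr 1
      · rw [M_entry _ _ hD, M_entry _ _ hD]
        generalize (i (Fin.last (l+1))) = a
        generalize (j (Fin.last (l+1))) = b
        have hs : ∀ x y : Fin D, (if x = y then (1 : ℂ) else 0) = if y = x then 1 else 0 :=
          fun x y => by simp only [eq_comm]
        rw [hs f e, hs a b, hs f b, hs a e]
        ring
      · refine Finset.sum_congr rfl fun p _ => ?_
        rw [mul_comm, ih (Fin.init j), ih _ (Fin.init i)]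

lemma pd_step (D l : ℕ) (a b : Fin D) (g : Poly D) :
    pderiv a (stepL D l b g) = (if a = b then g else 0) + X b * pderiv a g -
      C (((D : ℂ) + 2 * (l : ℂ) - 2)⁻¹) * (2 * X a * pderiv b g + r2 D * pderiv a (pderiv b g)) := by
  classical
  rw [stepL_apply, map_sub, pderiv_C_mul, pderiv_mul, pderiv_mul, pd_r2, pderiv_X, Pi.single_apply]
  simp only [eq_comm (a := b), ite_mul, one_mul, zero_mul]

/-- The algebraic heart: the matrix `M` acts on gradients as the next harmonic step. -/
lemma M_key (D : ℕ) (hD : 2 ≤ D) (l : ℕ) (a b : Fin D) {g : Poly D}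
    (hg : g.IsHomogeneous (l + 1)) (hl : lap g = 0) :
    ∑ e : Fin D, ∑ f : Fin D, MStep D (l + 1) (e, a) (f, b) • stepL D l e (pderiv f g) =
      (((l : ℂ) + 1) / ((l : ℂ) + 2)) • pderiv a (stepL D (l + 1) b g) := by
  have hl2 : (l : ℂ) + 2 ≠ 0 := by exact_mod_cast (by omega : l + 2 ≠ 0)
  have key : ∑ e : Fin D, ∑ f : Fin D, MStep D (l + 1) (e, a) (f, b) • stepL D l e (pderiv f g) =
      ((l : ℂ) + 2)⁻¹ • ((if a = b then (1 : ℂ) else 0) • ∑ e, stepL D l e (pderiv e g) +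
        ((l : ℂ) + 1) • stepL D l b (pderiv a g) -
        (2 * ((l : ℂ) + 1) * ((D : ℂ) + 2 * ((l + 1 : ℕ) : ℂ) - 2)⁻¹) • stepL D l a (pderiv b g)) := by
    simp only [M_entry _ _ (by omega : D ≠ 0), mul_smul, sub_smul, add_smul, ← Finset.smul_sum,
      Finset.sum_sub_distrib, Finset.sum_add_distrib, ite_smul, one_smul, zero_smul,
      Finset.sum_ite_eq, Finset.sum_ite_eq', Finset.mem_univ, if_true, smul_ite, smul_zero]
    push_cast
    simp [add_assoc, show (1 : ℂ) + 1 = 2 by norm_num]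
    simp only [add_smul, one_smul, smul_add]
  rw [key, sum_step_pd hg hl, pd_step, stepL_apply, stepL_apply, div_eq_inv_mul, mul_smul ((l : ℂ) + 2)⁻¹]
  congr 1
  rw [pd_comm b a]
  have hc : C (((D : ℂ) + 2 * (l : ℂ) - 2)⁻¹ * (1 - 2 * ((D : ℂ) + 2 * ((l + 1 : ℕ) : ℂ) - 2)⁻¹)) *
      pderiv a (pderiv b g) = C (((D : ℂ) + 2 * ((l + 1 : ℕ) : ℂ) - 2)⁻¹) *
      pderiv a (pderiv b g) := by
    have hd := den_ne D hD l
    rcases l with _ | l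
    · have : (pderiv b g).IsHomogeneous 0 := hg.pderiv
      rw [pd_hom0 this]; simp
    · have hd2 := den_ne D hD l
      congr 2
      have : ((D : ℂ) + 2 * ((l + 1 + 1 : ℕ) : ℂ) - 2) = ((D : ℂ) + 2 * ((l + 1 : ℕ) : ℂ) - 2) + 2 := by
        push_cast; ring
      rw [this] at hd ⊢
      field_simp
      ring
  simp only [smul_eq_C_mul]
  generalize ((D : ℂ) + 2 * ((l + 1 : ℕ) : ℂ) - 2)⁻¹ = t at hc ⊢
  generalize ((D : ℂ) + 2 * (l : ℂ) - 2)⁻¹ = s at hc ⊢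
  simp only [C_mul, C_sub, C_1, C_two] at hc ⊢
  split_ifs
  · simp only [C_1]
    linear_combination (-C ((l : ℂ) + 1) * r2 D) * hc
  · simp only [C_0]
    linear_combination (-C ((l : ℂ) + 1) * r2 D) * hc

lemma main_entry (D : ℕ) (hD : 2 ≤ D) (l : ℕ) (i j : Fin l → Fin D) :
    (l.factorial : ℂ) * symProj D l i j = constantCoeff (dd D l i (GG D l j)) := by
  induction l with
  | zero =>
    have : i = j := Subsingleton.elim _ _
    subst this
    simp [symProj, dd, GG]
  | succ l ih =>
    rcases l with _ | l
    · have : (i = j) ↔ (i 0 = j 0) :=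
        ⟨fun h => by rw [h], fun h => funext fun x => by
          rw [show x = 0 from Fin.ext (by have := x.isLt; simp at this ⊢), h]⟩
      classical
      simp [symProj, dd, GG, stepL_apply, Matrix.one_apply, this, pderiv_X, Pi.single_apply,
        eq_comm]
    · have hf : ((l + 1).factorial : ℂ) ≠ 0 := by exact_mod_cast Nat.factorial_ne_zero _
      have hl2 : (l : ℂ) + 2 ≠ 0 := by exact_mod_cast (by omega : l + 2 ≠ 0)
      rw [← Fin.snoc_init_self (α := fun _ => Fin D) i, ← Fin.snoc_init_self (α := fun _ => Fin D) j]
      generalize i (Fin.last (l + 1)) = a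
      generalize j (Fin.last (l + 1)) = b
      generalize (Fin.init i : Fin (l + 1) → Fin D) = i'
      generalize (Fin.init j : Fin (l + 1) → Fin D) = j'
      rw [sp_succ, dd_snoc, GG_snoc]
      have hin : ∀ e f : Fin D, ((l + 1).factorial : ℂ) ^ 2 * ∑ p : Fin l → Fin D,
          symProj D (l + 1) i' (Fin.snoc (α := fun _ => Fin D) p e) *
          symProj D (l + 1) (Fin.snoc (α := fun _ => Fin D) p f) j' =
          (l.factorial : ℂ) *
            constantCoeff (dd D (l + 1) i' (stepL D l e (pderiv f (GG D (l + 1) j')))) := by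
        intro e f
        have hr := repro (l := l) (g := pderiv f (GG D (l + 1) j')) (GG_hom D (l + 1) j').pderiv
          (by rw [lap_pd, GG_lap D hD, map_zero])
        have hr2 := congrArg (fun φ => constantCoeff (dd D (l + 1) i' (stepL D l e φ))) hr
        simp only [map_smul, map_sum, constantCoeff_smul, smul_eq_mul] at hr2
        rw [← hr2, Finset.mul_sum]
        refine Finset.sum_congr rfl fun p _ => ?_
        have e1 := ih i' (Fin.snoc (α := fun _ => Fin D) p e)
        have e2 := ih (Fin.snoc (α := fun _ => Fin D) p f) j'
        rw [GG_snoc] at e1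
        rw [dd_snoc] at e2
        rw [← e1, ← e2]
        ring
      have hk := congrArg (fun φ => constantCoeff (dd D (l + 1) i' φ))
        (M_key D hD l a b (GG_hom D (l + 1) j') (GG_lap D hD (l + 1) j'))
      simp only [map_smul, map_sum, constantCoeff_smul, smul_eq_mul] at hk
      have hsum : ((l + 1).factorial : ℂ) ^ 2 * ∑ e : Fin D, ∑ f : Fin D,
          MStep D (l + 1) (e, a) (f, b) * ∑ p : Fin l → Fin D,
          symProj D (l + 1) i' (Fin.snoc (α := fun _ => Fin D) p e) *
          symProj D (l + 1) (Fin.snoc (α := fun _ => Fin D) p f) j' =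
          (l.factorial : ℂ) * ∑ e : Fin D, ∑ f : Fin D, MStep D (l + 1) (e, a) (f, b) *
            constantCoeff (dd D (l + 1) i' (stepL D l e (pderiv f (GG D (l + 1) j')))) := by
        simp only [Finset.mul_sum (s := (Finset.univ : Finset (Fin D)))]
        refine Finset.sum_congr rfl fun e _ => Finset.sum_congr rfl fun f _ => ?_
        rw [mul_left_comm, hin, mul_left_comm]
      rw [hk] at hsum
      apply mul_left_cancel₀ hf
      have hfac : ((l + 1 + 1).factorial : ℂ) = ((l : ℂ) + 2) * ((l + 1).factorial : ℂ) := by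
        rw [Nat.factorial_succ (l + 1)]; push_cast; ring
      have hfac1 : ((l + 1).factorial : ℂ) = ((l : ℂ) + 1) * (l.factorial : ℂ) := by
        rw [Nat.factorial_succ l]; push_cast; ring
      rw [hfac, show ∀ x : ℂ, ((l + 1).factorial : ℂ) * (((l : ℂ) + 2) * ((l + 1).factorial : ℂ) * x) =
        ((l : ℂ) + 2) * (((l + 1).factorial : ℂ) ^ 2 * x) from fun x => by ring, hsum, hfac1]
      field_simp

lemma sp_cons_snoc (D : ℕ) (hD : 2 ≤ D) (l : ℕ) (i : Fin l → Fin D) (a : Fin D)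
    (j : Fin (l + 1) → Fin D) :
    symProj D (l + 1) (Fin.cons (α := fun _ => Fin D) a i) j =
      symProj D (l + 1) (Fin.snoc (α := fun _ => Fin D) i a) j := by
  have hf : ((l + 1).factorial : ℂ) ≠ 0 := by exact_mod_cast Nat.factorial_ne_zero _
  apply mul_left_cancel₀ hf
  rw [main_entry D hD, main_entry D hD, dd_cons, dd_snoc]

lemma harm_eq (D : ℕ) (hD : 2 ≤ D) (l : ℕ) (i : Fin l → Fin D) : harmX D l i = GG D l i := by
  have hf : (l.factorial : ℂ) ≠ 0 := by exact_mod_cast Nat.factorial_ne_zero _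
  apply smul_right_injective _ hf
  change (l.factorial : ℂ) • harmX D l i = (l.factorial : ℂ) • GG D l i
  rw [← taylor (GG_hom D l i), harmX, Finset.smul_sum]
  refine Finset.sum_congr rfl fun j _ => ?_
  rw [smul_smul, sp_symm D (by omega), main_entry D hD]

lemma GG_cons (D : ℕ) (hD : 2 ≤ D) (l : ℕ) (i : Fin l → Fin D) (a : Fin D) :
    GG D (l + 1) (Fin.cons (α := fun _ => Fin D) a i) = stepL D l a (GG D l i) := by
  rw [← GG_snoc, ← harm_eq D hD, ← harm_eq D hD]
  simp only [harmX, sp_cons_snoc D hD]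

lemma ang_eq (D : ℕ) (h k : Fin D) (φ : Poly D) :
    Complex.I • ang h k φ = X h * pderiv k φ - X k * pderiv h φ := by
  rw [ang, smul_smul, Complex.I_mul_I]
  simp

/-- Contraction of `𝒫^{l+1}` with the harmonic polynomials of degree `l`. -/
lemma contract_one (D : ℕ) (hD : 2 ≤ D) (l : ℕ) (a : Fin D) (i : Fin (l + 1) → Fin D) :
    ∑ j : Fin l → Fin D, symProj D (l + 1) i (Fin.cons (α := fun _ => Fin D) a j) • GG D l j =
      ((l : ℂ) + 1)⁻¹ • pderiv a (GG D (l + 1) i) := by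
  have hf : (l.factorial : ℂ) ≠ 0 := by exact_mod_cast Nat.factorial_ne_zero _
  have hl : (l : ℂ) + 1 ≠ 0 := by exact_mod_cast (by omega : l + 1 ≠ 0)
  have hr := repro (l := l) (g := pderiv a (GG D (l + 1) i)) (GG_hom D (l + 1) i).pderiv
          (by rw [lap_pd, GG_lap D hD, map_zero])
  simp only [← dd_cons, ← main_entry D hD] at hr
  simp only [mul_smul, ← Finset.smul_sum] at hr
  have h2 : ∑ j : Fin l → Fin D, symProj D (l + 1) (Fin.cons (α := fun _ => Fin D) a j) i • GG D l j
     = ((l : ℂ) + 1)⁻¹ • pderiv a (GG D (l + 1) i) := by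
    apply smul_right_injective _ (show ((l + 1).factorial : ℂ) ≠ 0 by
      exact_mod_cast Nat.factorial_ne_zero _)
    change ((l + 1).factorial : ℂ) • _ = ((l + 1).factorial : ℂ) • _
    rw [hr, smul_smul]
    congr 1
    rw [Nat.factorial_succ]
    push_cast
    field_simp
  rw [← h2]
  refine Finset.sum_congr rfl fun j _ => ?_
  rw [sp_symm D (by omega)]

end helpers

/-- Action of `iL_{hk}` on `X_l` (for `l ≥ 1`, written `l = m+1`),
in its two equivalent forms. -/
theorem statement6 (D : ℕ) (hD : 2 ≤ D) (m : ℕ) (h k : Fin D)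
    (i : Fin (m + 1) → Fin D) :
    Complex.I • ang h k (harmX D (m + 1) i) =
      (((m : ℂ) + 1) * (zetaSucc D (m + 2) / zetaSucc D (m + 1))) •
        ∑ j : Fin (m + 1) → Fin D,
          (symProj D (m + 2) (Fin.cons h i) (Fin.cons k j) -
            symProj D (m + 2) (Fin.cons k i) (Fin.cons h j)) • harmX D (m + 1) j ∧
    Complex.I • ang h k (harmX D (m + 1) i) =
      ((m : ℂ) + 1) •
        ∑ j : Fin (m + 1) → Fin D, symProj D (m + 1) i j •
          ((if j 0 = k then (1 : ℂ) else 0) • harmX D (m + 1) (Fin.cons h (Fin.tail j)) -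
            (if j 0 = h then (1 : ℂ) else 0) • harmX D (m + 1) (Fin.cons k (Fin.tail j))) := by
  have hm1 : (m : ℂ) + 1 ≠ 0 := by exact_mod_cast (by omega : m + 1 ≠ 0)
  have hm2 : (m : ℂ) + 2 ≠ 0 := by exact_mod_cast (by omega : m + 2 ≠ 0)
  have hD0 : (D : ℂ) ≠ 0 := by exact_mod_cast (by omega : D ≠ 0)
  have hd1 := den_ne D hD m
  have hd2 := den_ne D hD (m + 1)
  simp only [harm_eq D hD, ang_eq]
  constructor
  · have hc : ∀ a b : Fin D, ∑ j : Fin (m + 1) → Fin D,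
        symProj D (m + 2) (Fin.cons a i) (Fin.cons b j) • GG D (m + 1) j =
        ((m : ℂ) + 2)⁻¹ • MvPolynomial.pderiv b (stepL D (m + 1) a (GG D (m + 1) i)) := by
      intro a b
      have := contract_one D hD (m + 1) b (Fin.cons a i)
      rw [GG_cons D hD] at this
      rw [this]
      push_cast
      ring_nf
    simp only [sub_smul, Finset.sum_sub_distrib]
    rw [hc h k, hc k h, pd_step, pd_step, pd_comm h k]
    generalize GG D (m + 1) i = g
    have hz : ((m : ℂ) + 1) * (zetaSucc D (m + 2) / zetaSucc D (m + 1)) * ((m : ℂ) + 2)⁻¹ *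
        (1 + 2 * ((D : ℂ) + 2 * ((m + 1 : ℕ) : ℂ) - 2)⁻¹) = 1 := by
      have e2 : ((D : ℂ) + 2 * ((m + 1 + 1 : ℕ) : ℂ) - 2) =
          ((D : ℂ) + 2 * ((m + 1 : ℕ) : ℂ) - 2) + 2 := by push_cast; ring
      have z2 : zetaSucc D (m + 2) = (D : ℂ) * ((m : ℂ) + 2) /
          (((D : ℂ) + 2 * ((m + 1 : ℕ) : ℂ) - 2) + 2) := by
        rw [← e2, zetaSucc]; push_cast; ring_nf
      have z1 : zetaSucc D (m + 1) = (D : ℂ) * ((m : ℂ) + 1) /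
          ((D : ℂ) + 2 * ((m + 1 : ℕ) : ℂ) - 2) := by
        rw [zetaSucc]; push_cast; ring_nf
      rw [z1, z2]
      rw [e2] at hd2
      generalize ((D : ℂ) + 2 * ((m + 1 : ℕ) : ℂ) - 2) = s at hd1 hd2 ⊢
      field_simp
    have hC := congrArg (MvPolynomial.C (σ := Fin D)) hz
    rw [← smul_sub, smul_smul, MvPolynomial.smul_eq_C_mul]
    simp only [MvPolynomial.C_mul, MvPolynomial.C_add, MvPolynomial.C_1, C_two] at hC ⊢
    rw [show (if h = k then g else 0) = (if k = h then g else 0) by simp only [eq_comm]]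
    linear_combination (-(MvPolynomial.X h * MvPolynomial.pderiv k g -
      MvPolynomial.X k * MvPolynomial.pderiv h g)) * hC
  · have hc : ∀ a b : Fin D, ∑ j : Fin (m + 1) → Fin D, symProj D (m + 1) i j •
        (if j 0 = b then (1 : ℂ) else 0) • GG D (m + 1) (Fin.cons a (Fin.tail j)) =
        ((m : ℂ) + 1)⁻¹ • stepL D m a (MvPolynomial.pderiv b (GG D (m + 1) i)) := by
      intro a b
      rw [sum_cons]
      simp only [Fin.cons_zero, Fin.tail_cons, ite_smul, one_smul, zero_smul, smul_ite, smul_zero]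
      rw [Finset.sum_comm]
      simp only [Finset.sum_ite_eq', Finset.mem_univ, if_true, GG_cons D hD]
      rw [← map_smul, ← contract_one D hD, map_sum]
      simp only [map_smul]
    simp only [smul_sub, Finset.sum_sub_distrib, hc]
    rw [smul_smul, smul_smul, mul_inv_cancel₀ hm1, one_smul, one_smul, stepL_apply, stepL_apply,
      pd_comm h k]
    ring

end Fuzzy
end
end
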